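/- For every LTL formula φ and every infinite word w ∈ (2^AP)^ω, setting U = {Xψ ∈ el(φ) : w ⊨ ψ}, one has w ∈ L(A_φ^U). Consequently the restriction of A_φ to the states 2^{el(φ)}, with all of them taken as initial, is fully partitioned: the languages L(A_φ^U) for U ⊆ el(φ) are pairwise disjoint and their union is all of (2^AP)^ω. -/

import Mathlib

open scoped ENNReal

/-- LTL formulas over atomic propositions `AP`. -/
inductive LTL (AP : Type) : Type
  | atom : AP → LTL AP
  | neg : LTL AP → LTL AP
  | conj : LTL AP → LTL AP → LTL AP
  | next : LTL AP → LTL AP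
  | untl : LTL AP → LTL AP → LTL AP

namespace LTL

/-- Semantics of LTL over infinite words `w : ℕ → Set AP`. -/
def Sat {AP : Type} : (ℕ → Set AP) → LTL AP → Prop
  | w, atom p => p ∈ w 0
  | w, neg φ => ¬ Sat w φ
  | w, conj φ ψ => Sat w φ ∧ Sat w ψ
  | w, next φ => Sat (fun i => w (i + 1)) φ
  | w, untl φ ψ =>
      ∃ j : ℕ, Sat (fun i => w (i + j)) ψ ∧ ∀ i < j, Sat (fun k => w (k + i)) φ

/-- `Subf ψ φ` : `ψ` is a subformula of `φ`. -/
inductive Subf {AP : Type} : LTL AP → LTL AP → Prop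
  | refl (φ : LTL AP) : Subf φ φ
  | negI {ψ φ : LTL AP} : Subf ψ φ → Subf ψ (neg φ)
  | conjL {ψ φ₁ φ₂ : LTL AP} : Subf ψ φ₁ → Subf ψ (conj φ₁ φ₂)
  | conjR {ψ φ₁ φ₂ : LTL AP} : Subf ψ φ₂ → Subf ψ (conj φ₁ φ₂)
  | nextI {ψ φ : LTL AP} : Subf ψ φ → Subf ψ (next φ)
  | untlL {ψ φ₁ φ₂ : LTL AP} : Subf ψ φ₁ → Subf ψ (untl φ₁ φ₂)
  | untlR {ψ φ₁ φ₂ : LTL AP} : Subf ψ φ₂ → Subf ψ (untl φ₁ φ₂)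

/-- Elementary formulas `el φ`. -/
def el {AP : Type} : LTL AP → Set (LTL AP)
  | atom _ => ∅
  | neg ψ => el ψ
  | conj φ ψ => el φ ∪ el ψ
  | next ψ => insert (next ψ) (el ψ)
  | untl φ ψ => insert (next (untl φ ψ)) (el φ ∪ el ψ)

/-- The satisfaction relation `(V, a) ⊩ ψ`. -/
def sd {AP : Type} (V : Set (LTL AP)) (a : Set AP) : LTL AP → Prop
  | atom p => p ∈ a
  | neg ψ => ¬ sd V a ψ
  | conj φ ψ => sd V a φ ∧ sd V a ψ
  | next ψ => next ψ ∈ V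
  | untl φ ψ => sd V a ψ ∨ (sd V a φ ∧ next (untl φ ψ) ∈ V)

end LTL

/-- A generalized Büchi automaton with alphabet `Al` and state space `Q`. -/
structure GBA (Al : Type) (Q : Type) where
  T : Q → Al → Set Q
  init : Set Q
  acc : Set (Set (Q × Al × Q))

namespace GBA

variable {Al Q : Type}

/-- A run of the automaton over the word `w`. -/
def IsRun (Au : GBA Al Q) (w : ℕ → Al) (ρ : ℕ → Q) : Prop :=
  ρ 0 ∈ Au.init ∧ ∀ i, ρ (i + 1) ∈ Au.T (ρ i) (w i)

/-- An accepting run: for each accepting set, some transition in it occurs at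
infinitely many positions. -/
def IsAcceptingRun (Au : GBA Al Q) (w : ℕ → Al) (ρ : ℕ → Q) : Prop :=
  Au.IsRun w ρ ∧ ∀ F ∈ Au.acc, {i : ℕ | (ρ i, w i, ρ (i + 1)) ∈ F}.Infinite

/-- The language of the automaton. -/
def Lang (Au : GBA Al Q) : Set (ℕ → Al) :=
  {w | ∃ ρ : ℕ → Q, Au.IsAcceptingRun w ρ}

/-- The automaton `Au` with single initial state `q`. -/
def from1 (Au : GBA Al Q) (q : Q) : GBA Al Q :=
  { Au with init := {q} }

/-- The language of the automaton started in state `q`. -/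
def LangFrom (Au : GBA Al Q) (q : Q) : Set (ℕ → Al) :=
  (Au.from1 q).Lang

/-- Separated automaton: distinct states recognize disjoint languages. -/
def Separated (Au : GBA Al Q) : Prop :=
  ∀ q q' : Q, q ≠ q' → Au.LangFrom q ∩ Au.LangFrom q' = ∅

/-- Reverse determinism: every state has exactly one `a`-predecessor for each letter `a`. -/
def RevDet (Au : GBA Al Q) : Prop :=
  ∀ (q' : Q) (a : Al), ∃! q : Q, q' ∈ Au.T q a

/-- Fully partitioned automaton: separated, every word is accepted from some
state, and reverse deterministic. -/
def FullyPartitioned (Au : GBA Al Q) : Prop :=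
  Au.Separated ∧ (∀ w : ℕ → Al, ∃ q : Q, w ∈ Au.LangFrom q) ∧ Au.RevDet

/-- A state is reenterable if it has some predecessor. -/
def Reenterable (Au : GBA Al Q) (q : Q) : Prop :=
  ∃ (p : Q) (a : Al), q ∈ Au.T p a

/-- The restriction of an automaton to its reenterable states, all of them initial. -/
def restrict (Au : GBA Al Q) : GBA Al {q : Q // Au.Reenterable q} where
  T q a := {q' | q'.1 ∈ Au.T q.1 a}
  init := Set.univ
  acc := (fun F => {t : {q : Q // Au.Reenterable q} × Al × {q : Q // Au.Reenterable q} |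
            (t.1.1, t.2.1, t.2.2.1) ∈ F}) '' Au.acc

/-- Almost fully partitioned: the restriction to reenterable states is fully partitioned. -/
def AlmostFullyPartitioned (Au : GBA Al Q) : Prop :=
  Au.restrict.FullyPartitioned

end GBA

/-- The transition function of the automaton `A_φ`; the state `none` is the
initial state `φ`, the state `some V` is the subset state `V ⊆ el φ`. -/
def autT {AP : Type} (φ : LTL AP) :
    Option (Set (LTL AP)) → Set AP → Set (Option (Set (LTL AP)))
  | none, a => {q' | ∃ V : Set (LTL AP), q' = some V ∧ V ⊆ φ.el ∧ LTL.sd V a φ}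
  | some V, a => {q' | ∃ U : Set (LTL AP), q' = some U ∧ U ⊆ φ.el ∧
      ∀ ψ : LTL AP, LTL.next ψ ∈ φ.el → (LTL.next ψ ∈ V ↔ LTL.sd U a ψ)}

/-- The generalized Büchi automaton `A_φ` of an LTL formula `φ`. -/
def aut {AP : Type} (φ : LTL AP) : GBA (Set AP) (Option (Set (LTL AP))) where
  T := autT φ
  init := {none}
  acc := {F | ∃ φ₁ φ₂ : LTL AP, LTL.Subf (LTL.untl φ₁ φ₂) φ ∧
    F = {t : Option (Set (LTL AP)) × Set AP × Option (Set (LTL AP)) |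
          t.2.2 ∈ autT φ t.1 t.2.1 ∧
          ∃ V : Set (LTL AP), t.2.2 = some V ∧
            (LTL.sd V t.2.1 φ₂ ∨ ¬ LTL.sd V t.2.1 (LTL.untl φ₁ φ₂))}}

/-- The automaton `A_φ^U` for `U ⊆ el φ`. -/
def autFrom {AP : Type} (φ : LTL AP) (U : Set (LTL AP)) :
    GBA (Set AP) (Option (Set (LTL AP))) :=
  (aut φ).from1 (some U)

/-- A (finite, labelled) Markov chain with state space `S` and labels in `Al`. -/
structure MC (S : Type) (Al : Type) where
  L : S → Al
  init : S
  P : S → S → ℝ≥0∞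

namespace MC

variable {S Al : Type}

/-- The edge relation of the underlying graph of the Markov chain. -/
def E (M : MC S Al) : S → S → Prop := fun s s' => 0 < M.P s s'

/-- The labelled word generated by a path of the Markov chain. -/
def word (M : MC S Al) (π : ℕ → S) : ℕ → Al := fun i => M.L (π i)

end MC

/-- The edge relation of the product graph `A × M`. -/
def prodE {S Al Q : Type} (Au : GBA Al Q) (M : MC S Al) : Q × S → Q × S → Prop :=
  fun v v' => M.E v.2 v'.2 ∧ v'.1 ∈ Au.T v.1 (M.L v.2)

/-- All vertices of `C` are mutually reachable. -/
def MutReach {V : Type} (E : V → V → Prop) (C : Set V) : Prop :=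
  ∀ u ∈ C, ∀ v ∈ C, Relation.ReflTransGen E u v

/-- `C` is a (non-extensible, i.e. maximal) strongly connected component. -/
def IsSCC {V : Type} (E : V → V → Prop) (C : Set V) : Prop :=
  C.Nonempty ∧ MutReach E C ∧ ∀ C' : Set V, C ⊆ C' → MutReach E C' → C' = C

/-- `SCCle E C C'` : some vertex of `C'` is reachable from some vertex of `C`. -/
def SCCle {V : Type} (E : V → V → Prop) (C C' : Set V) : Prop :=
  ∃ u ∈ C, ∃ v ∈ C', Relation.ReflTransGen E u v

/-- A bottom SCC: an SCC maximal with respect to reachability. -/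
def IsBSCC {V : Type} (E : V → V → Prop) (C : Set V) : Prop :=
  IsSCC E C ∧ ∀ C' : Set V, IsSCC E C' → SCCle E C C' → C' = C

/-- A finite path of the graph `E` lying in the set `C`. -/
def FinPathIn {V : Type} (E : V → V → Prop) (C : Set V) (l : List V) : Prop :=
  l.Chain' E ∧ ∀ v ∈ l, v ∈ C

/-- An infinite path of the graph `E` lying in the set `C`. -/
def InfPathIn {V : Type} (E : V → V → Prop) (C : Set V) (π : ℕ → V) : Prop :=
  (∀ i, E (π i) (π (i + 1))) ∧ ∀ i, π i ∈ C

/-- The infinite path `π` visits the finite path `l` infinitely often, i.e. `l`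
occurs as a contiguous fragment starting at infinitely many positions of `π`. -/
def VisitsInfOften {V : Type} (π : ℕ → V) (l : List V) : Prop :=
  {n : ℕ | ∀ i : Fin l.length, π (n + i.1) = l.get i}.Infinite

/-- The projection `H(C)` of a set of product vertices to the Markov chain. -/
def Hproj {Q S : Type} (C : Set (Q × S)) : Set S := Prod.snd '' C

/-- A complete SCC of the product graph: every finite path of `H(C)` is the
projection of some finite path in `C`. -/
def CompleteSCC {S Al Q : Type} (Au : GBA Al Q) (M : MC S Al) (C : Set (Q × S)) : Prop :=
  ∀ l : List S, FinPathIn M.E (Hproj C) l →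
    ∃ σ : List (Q × S), FinPathIn (prodE Au M) C σ ∧ σ.map Prod.snd = l

/-- An accepting SCC of the product graph. -/
def AcceptingSCC {S Al Q : Type} (Au : GBA Al Q) (M : MC S Al) (C : Set (Q × S)) : Prop :=
  ∀ F ∈ Au.acc, ∃ v ∈ C, ∃ v' ∈ C, prodE Au M v v' ∧ (v.1, M.L v.2, v'.1) ∈ F

/-- A locally positive SCC: accepting, complete, and `H(C)` is a bottom SCC of
the underlying graph of `M`. -/
def LocallyPositive {S Al Q : Type} (Au : GBA Al Q) (M : MC S Al) (C : Set (Q × S)) : Prop :=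
  AcceptingSCC Au M C ∧ CompleteSCC Au M C ∧ IsBSCC M.E (Hproj C)

/-- The σ-algebra on `ℕ → S` generated by the cylinder sets. -/
def CylSigma (S : Type) : MeasurableSpace (ℕ → S) :=
  MeasurableSpace.generateFrom
    {A : Set (ℕ → S) | ∃ l : List S, A = {π | ∀ i : Fin l.length, π i.1 = l.get i}}

/-- `μ` is the path measure of the Markov chain with transition matrix `P` and
initial state `s`: the measure of each cylinder is the product of the transition
probabilities along it. -/
def IsPathMeasure {S : Type} [DecidableEq S] (P : S → S → ℝ≥0∞) (s : S)
    (μ : @MeasureTheory.Measure (ℕ → S) (CylSigma S)) : Prop :=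
  ∀ (k : ℕ) (f : ℕ → S),
    μ {π | ∀ i ≤ k, π i = f i} =
      (if f 0 = s then 1 else 0) * ∏ i ∈ Finset.range k, P (f i) (f (i + 1))

namespace LTL

variable {AP : Type}

/-- The `i`-th suffix of an infinite word. -/
def suffix {α : Type} (w : ℕ → α) (i : ℕ) : ℕ → α := fun k => w (k + i)

theorem suffix_zero {α : Type} (w : ℕ → α) : suffix w 0 = w := rfl

theorem suffix_suffix {α : Type} (w : ℕ → α) (i j : ℕ) :
    suffix (suffix w i) j = suffix w (i + j) := by
  funext k
  simp only [suffix]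
  congr 1
  omega

theorem Subf.trans {ψ χ φ : LTL AP} (h₁ : Subf ψ χ) (h₂ : Subf χ φ) : Subf ψ φ := by
  induction h₂ with
  | refl => exact h₁
  | negI _ ih => exact .negI ih
  | conjL _ ih => exact .conjL ih
  | conjR _ ih => exact .conjR ih
  | nextI _ ih => exact .nextI ih
  | untlL _ ih => exact .untlL ih
  | untlR _ ih => exact .untlR ih

theorem Subf.el_subset {ψ φ : LTL AP} (h : Subf ψ φ) : ψ.el ⊆ φ.el := by
  induction h with
  | refl => exact subset_rfl
  | negI _ ih => exact ih
  | conjL _ ih => exact ih.trans Set.subset_union_left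
  | conjR _ ih => exact ih.trans Set.subset_union_right
  | nextI _ ih => exact ih.trans (Set.subset_insert _ _)
  | untlL _ ih => exact ih.trans (Set.subset_union_left.trans (Set.subset_insert _ _))
  | untlR _ ih => exact ih.trans (Set.subset_union_right.trans (Set.subset_insert _ _))

/-- Every elementary formula is of the form `Xψ` for a subformula `ψ`. -/
theorem exists_eq_next_of_mem_el {χ φ : LTL AP} (h : χ ∈ φ.el) :
    ∃ ψ, χ = next ψ ∧ Subf ψ φ := by
  induction φ with
  | atom p => exact h.elim
  | neg φ ih =>
    obtain ⟨ψ, e, hs⟩ := ih h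
    exact ⟨ψ, e, .negI hs⟩
  | conj φ₁ φ₂ ih₁ ih₂ =>
    rcases h with h | h
    · obtain ⟨ψ, e, hs⟩ := ih₁ h
      exact ⟨ψ, e, .conjL hs⟩
    · obtain ⟨ψ, e, hs⟩ := ih₂ h
      exact ⟨ψ, e, .conjR hs⟩
  | next φ ih =>
    rcases h with h | h
    · exact ⟨φ, h, .nextI (.refl φ)⟩
    · obtain ⟨ψ, e, hs⟩ := ih h
      exact ⟨ψ, e, .nextI hs⟩
  | untl φ₁ φ₂ ih₁ ih₂ =>
    rcases h with h | h | h
    · exact ⟨_, h, .refl _⟩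
    · obtain ⟨ψ, e, hs⟩ := ih₁ h
      exact ⟨ψ, e, .untlL hs⟩
    · obtain ⟨ψ, e, hs⟩ := ih₂ h
      exact ⟨ψ, e, .untlR hs⟩

theorem subf_of_next_mem_el {ψ φ : LTL AP} (h : next ψ ∈ φ.el) : Subf ψ φ := by
  obtain ⟨ψ', e, hs⟩ := exists_eq_next_of_mem_el h
  cases e
  exact hs

theorem sat_next_suffix (w : ℕ → Set AP) (i : ℕ) (ψ : LTL AP) :
    Sat (suffix w i) (next ψ) ↔ Sat (suffix w (i + 1)) ψ := by
  rw [← suffix_suffix, Sat]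
  rfl

theorem sat_untl_suffix (w : ℕ → Set AP) (i : ℕ) (φ ψ : LTL AP) :
    Sat (suffix w i) (untl φ ψ) ↔
      ∃ j, Sat (suffix w (i + j)) ψ ∧ ∀ m < j, Sat (suffix w (i + m)) φ := by
  simp only [← suffix_suffix]
  rw [Sat]
  rfl

/-- The expansion law for the until operator. -/
theorem sat_untl_suffix_iff (w : ℕ → Set AP) (i : ℕ) (φ ψ : LTL AP) :
    Sat (suffix w i) (untl φ ψ) ↔
      Sat (suffix w i) ψ ∨ (Sat (suffix w i) φ ∧ Sat (suffix w (i + 1)) (untl φ ψ)) := by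
  simp only [sat_untl_suffix]
  constructor
  · rintro ⟨_ | j, hj, hlt⟩
    · exact .inl hj
    · refine .inr ⟨hlt 0 j.succ_pos, j, ?_, fun m hm => ?_⟩
      · rwa [add_assoc, add_comm 1]
      · rw [add_assoc, add_comm 1]
        exact hlt (m + 1) (by omega)
  · rintro (h | ⟨h, j, hj, hlt⟩)
    · exact ⟨0, h, by simp⟩
    · refine ⟨j + 1, by rwa [add_comm j, ← add_assoc], ?_⟩
      rintro (_ | m) hm
      · exact h
      · rw [add_comm m, ← add_assoc]
        exact hlt m (by omega)

/-- The set `{Xψ ∈ el φ : w ⊨ ψ}`. -/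
def satSet (φ : LTL AP) (w : ℕ → Set AP) : Set (LTL AP) :=
  {χ | χ ∈ φ.el ∧ ∃ ψ : LTL AP, χ = next ψ ∧ Sat w ψ}

theorem satSet_subset (φ : LTL AP) (w : ℕ → Set AP) : satSet φ w ⊆ φ.el :=
  fun _ h => h.1

theorem next_mem_satSet {φ ψ : LTL AP} {w : ℕ → Set AP} (h : next ψ ∈ φ.el) :
    next ψ ∈ satSet φ w ↔ Sat w ψ := by
  constructor
  · rintro ⟨_, ψ', e, hs⟩
    cases e
    exact hs
  · exact fun hs => ⟨h, ψ, rfl, hs⟩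

theorem sd_satSet {φ ψ : LTL AP} (w : ℕ → Set AP) (i : ℕ) (h : Subf ψ φ) :
    sd (satSet φ (suffix w (i + 1))) (w i) ψ ↔ Sat (suffix w i) ψ := by
  induction ψ with
  | atom p => simp [sd, Sat, suffix]
  | neg ψ ih => rw [sd, Sat, ih (.trans (.negI (.refl _)) h)]
  | conj φ₁ φ₂ ih₁ ih₂ =>
    rw [sd, Sat, ih₁ (.trans (.conjL (.refl _)) h), ih₂ (.trans (.conjR (.refl _)) h)]
  | next ψ ih =>
    rw [sd, next_mem_satSet (h.el_subset (Set.mem_insert _ _)), sat_next_suffix]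
  | untl φ₁ φ₂ ih₁ ih₂ =>
    rw [sd, ih₁ (.trans (.untlL (.refl _)) h), ih₂ (.trans (.untlR (.refl _)) h),
      next_mem_satSet (h.el_subset (Set.mem_insert _ _)), ← sat_untl_suffix_iff]

theorem exists_sat_or_not_sat_untl (w : ℕ → Set AP) (φ ψ : LTL AP) (n : ℕ) :
    ∃ i, n ≤ i ∧ (Sat (suffix w i) ψ ∨ ¬ Sat (suffix w i) (untl φ ψ)) := by
  by_cases h : Sat (suffix w n) (untl φ ψ)
  · obtain ⟨j, hj, -⟩ := (sat_untl_suffix w n φ ψ).1 h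
    exact ⟨n + j, by omega, .inl hj⟩
  · exact ⟨n, le_rfl, .inr h⟩

/-- A sequence of subsets of `el φ` that is consistent with the word `w` and fulfils every
until-subformula it promises evaluates all subformulas according to the LTL semantics. -/
theorem sd_iff_sat {φ ψ : LTL AP} {w : ℕ → Set AP} {V : ℕ → Set (LTL AP)}
    (hstep : ∀ i ψ, next ψ ∈ φ.el → (next ψ ∈ V i ↔ sd (V (i + 1)) (w i) ψ))
    (hacc : ∀ φ₁ φ₂, Subf (untl φ₁ φ₂) φ → ∀ n, ∃ i, n ≤ i ∧
      (sd (V (i + 1)) (w i) φ₂ ∨ ¬ sd (V (i + 1)) (w i) (untl φ₁ φ₂)))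
    (h : Subf ψ φ) (i : ℕ) :
    sd (V (i + 1)) (w i) ψ ↔ Sat (suffix w i) ψ := by
  induction ψ generalizing i with
  | atom p => simp [sd, Sat, suffix]
  | neg ψ ih => rw [sd, Sat, ih (.trans (.negI (.refl _)) h)]
  | conj φ₁ φ₂ ih₁ ih₂ =>
    rw [sd, Sat, ih₁ (.trans (.conjL (.refl _)) h), ih₂ (.trans (.conjR (.refl _)) h)]
  | next ψ ih =>
    rw [sd, hstep _ _ (h.el_subset (Set.mem_insert _ _)), ih (.trans (.nextI (.refl _)) h),
      sat_next_suffix]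
  | untl φ₁ φ₂ ih₁ ih₂ =>
    replace ih₁ := ih₁ (.trans (.untlL (.refl _)) h)
    replace ih₂ := ih₂ (.trans (.untlR (.refl _)) h)
    have expand (k : ℕ) : sd (V (k + 1)) (w k) (untl φ₁ φ₂) ↔ Sat (suffix w k) φ₂ ∨
        (Sat (suffix w k) φ₁ ∧ sd (V (k + 1 + 1)) (w (k + 1)) (untl φ₁ φ₂)) := by
      conv_lhs => rw [sd]
      rw [ih₁, ih₂, hstep _ _ (h.el_subset (Set.mem_insert _ _))]
    have of_sat (j k : ℕ) (hj : Sat (suffix w (k + j)) φ₂)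
        (hlt : ∀ m < j, Sat (suffix w (k + m)) φ₁) : sd (V (k + 1)) (w k) (untl φ₁ φ₂) := by
      induction j generalizing k with
      | zero => exact (expand k).2 (.inl hj)
      | succ j ih =>
        refine (expand k).2 (.inr ⟨hlt 0 j.succ_pos, ih (k + 1) ?_ fun m hm => ?_⟩)
        · rwa [add_assoc, add_comm 1]
        · rw [add_assoc, add_comm 1]
          exact hlt (m + 1) (by omega)
    obtain ⟨n, hn, hfair⟩ := hacc φ₁ φ₂ h i
    refine ⟨fun hu => ?_, fun hs => ?_⟩
    · induction hn using Nat.decreasingInduction with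
      | of_succ k hk ih =>
        rcases (expand k).1 hu with h₂ | ⟨h₁, hu'⟩
        · exact (sat_untl_suffix_iff w k φ₁ φ₂).2 (.inl h₂)
        · exact (sat_untl_suffix_iff w k φ₁ φ₂).2 (.inr ⟨h₁, ih hu'⟩)
      | self =>
        rcases hfair with h₂ | hnu
        · exact (sat_untl_suffix_iff w n φ₁ φ₂).2 (.inl ((ih₂ n).1 h₂))
        · exact absurd hu hnu
    · obtain ⟨j, hj, hlt⟩ := (sat_untl_suffix w i φ₁ φ₂).1 hs
      exact of_sat j i hj hlt

end LTL

theorem mem_lang_autFrom_satSet {AP : Type} (φ : LTL AP) (w : ℕ → Set AP) :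
    w ∈ (autFrom φ (LTL.satSet φ w)).Lang := by
  have step (i : ℕ) : some (LTL.satSet φ (LTL.suffix w (i + 1))) ∈
      autT φ (some (LTL.satSet φ (LTL.suffix w i))) (w i) := by
    refine ⟨_, rfl, LTL.satSet_subset _ _, fun ψ hψ => ?_⟩
    rw [LTL.next_mem_satSet hψ, LTL.sd_satSet w i (LTL.subf_of_next_mem_el hψ)]
  refine ⟨fun i => some (LTL.satSet φ (LTL.suffix w i)), ⟨rfl, step⟩, ?_⟩
  rintro F ⟨φ₁, φ₂, hs, rfl⟩
  refine Set.infinite_of_forall_exists_gt fun n => ?_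
  obtain ⟨i, hi, h⟩ := LTL.exists_sat_or_not_sat_untl w φ₁ φ₂ (n + 1)
  refine ⟨i, ⟨step i, _, rfl, ?_⟩, hi⟩
  rwa [LTL.sd_satSet w i hs, LTL.sd_satSet w i (.trans (.untlR (.refl _)) hs)]

theorem eq_satSet_of_mem_lang_autFrom {AP : Type} {φ : LTL AP} {U : Set (LTL AP)}
    {w : ℕ → Set AP} (hU : U ⊆ φ.el) (hw : w ∈ (autFrom φ U).Lang) :
    U = LTL.satSet φ w := by
  obtain ⟨ρ, ⟨h₀, hT⟩, hF⟩ := hw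
  replace h₀ : ρ 0 = some U := h₀
  have hsome (i : ℕ) : ∃ V, ρ i = some V := by
    cases i with
    | zero => exact ⟨U, h₀⟩
    | succ i =>
      have h : ρ (i + 1) ∈ autT φ (ρ i) (w i) := hT i
      cases hρ : ρ i <;> rw [hρ] at h <;> exact ⟨h.choose, h.choose_spec.1⟩
  choose V hV using hsome
  have hstep (i : ℕ) (ψ : LTL AP) (hψ : LTL.next ψ ∈ φ.el) :
      LTL.next ψ ∈ V i ↔ LTL.sd (V (i + 1)) (w i) ψ := by
    have h : ρ (i + 1) ∈ autT φ (ρ i) (w i) := hT i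
    rw [hV i, hV (i + 1)] at h
    obtain ⟨V', e, -, h⟩ := h
    cases e
    exact h ψ hψ
  have hacc (φ₁ φ₂ : LTL AP) (hs : LTL.Subf (.untl φ₁ φ₂) φ) (n : ℕ) : ∃ i, n ≤ i ∧
      (LTL.sd (V (i + 1)) (w i) φ₂ ∨ ¬ LTL.sd (V (i + 1)) (w i) (.untl φ₁ φ₂)) := by
    obtain ⟨i, ⟨-, V', e, h⟩, hi⟩ := (hF _ ⟨φ₁, φ₂, hs, rfl⟩).exists_gt n
    rw [hV (i + 1)] at e
    cases e
    exact ⟨i, hi.le, h⟩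
  have hV₀ : V 0 = U := Option.some.inj ((hV 0).symm.trans h₀)
  have key {ψ : LTL AP} (hψ : LTL.next ψ ∈ φ.el) : LTL.next ψ ∈ U ↔ LTL.Sat w ψ := by
    rw [← hV₀, hstep 0 ψ hψ, LTL.sd_iff_sat hstep hacc (LTL.subf_of_next_mem_el hψ),
      LTL.suffix_zero]
  ext χ
  constructor
  · intro hχ
    obtain ⟨ψ, rfl, -⟩ := LTL.exists_eq_next_of_mem_el (hU hχ)
    exact ⟨hU hχ, ψ, rfl, (key (hU hχ)).1 hχ⟩
  · rintro ⟨hχ, ψ, rfl, hs⟩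
    exact (key hχ).2 hs

/-- For every LTL formula `φ` and every infinite word `w`, setting
`U = {X ψ ∈ el φ : w ⊨ ψ}`, one has `w ∈ L(A_φ^U)`. Consequently the restriction
of `A_φ` to the subset states, with all of them initial, is fully partitioned:
the languages `L(A_φ^U)` for `U ⊆ el φ` are pairwise disjoint and their union is
all of `(2^AP)^ω`. -/
theorem aut_fully_partitioned {AP : Type} [Fintype AP] (φ : LTL AP) :
    (∀ w : ℕ → Set AP,
      w ∈ (autFrom φ {χ | χ ∈ φ.el ∧ ∃ ψ : LTL AP, χ = LTL.next ψ ∧ LTL.Sat w ψ}).Lang) ∧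
    (∀ U V : Set (LTL AP), U ⊆ φ.el → V ⊆ φ.el → U ≠ V →
      (autFrom φ U).Lang ∩ (autFrom φ V).Lang = ∅) ∧
    (∀ w : ℕ → Set AP, ∃ U : Set (LTL AP), U ⊆ φ.el ∧ w ∈ (autFrom φ U).Lang) := by
  refine ⟨mem_lang_autFrom_satSet φ, fun U V hU hV hne => ?_, fun w =>
    ⟨_, LTL.satSet_subset φ w, mem_lang_autFrom_satSet φ w⟩⟩
  refine Set.eq_empty_of_forall_notMem fun w hw => hne ?_
  rw [eq_satSet_of_mem_lang_autFrom hU hw.1, eq_satSet_of_mem_lang_autFrom hV hw.2]
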